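/- Let w ∈ C²(Ω̄; ℝ^d) satisfy Δw = 0 in Ω together with the boundary conditions w·n = 0 and 𝒩w = 0 on ∂Ω. Then w = 0 on Ω. -/

import Mathlib

open MeasureTheory Real Filter Set
open scoped Topology

noncomputable section

/-- Euclidean space `ℝ^d`. -/
abbrev Ed (d : ℕ) := EuclideanSpace ℝ (Fin d)

/-- Partial derivative of a scalar function in the `i`-th coordinate direction. -/
def pd {d : ℕ} (i : Fin d) (f : Ed d → ℝ) (x : Ed d) : ℝ :=
  fderiv ℝ f x (EuclideanSpace.single i 1)

/-- Divergence of a vector field. -/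
def divg {d : ℕ} (w : Ed d → Ed d) (x : Ed d) : ℝ :=
  ∑ i, pd i (fun y => w y i) x

/-- Laplacian of a scalar function. -/
def lap {d : ℕ} (f : Ed d → ℝ) (x : Ed d) : ℝ :=
  ∑ i, pd i (fun y => pd i f y) x

/-- Squared euclidean norm of the gradient of a scalar function. -/
def gradNormSq {d : ℕ} (f : Ed d → ℝ) (x : Ed d) : ℝ :=
  ∑ i, (pd i f x) ^ 2

/-- Squared Frobenius norm of the Hessian of a scalar function. -/
def hessNormSq {d : ℕ} (f : Ed d → ℝ) (x : Ed d) : ℝ :=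
  ∑ i, ∑ j, (pd i (fun y => pd j f y) x) ^ 2

/-- The antisymmetric curl two-form `(curl w)ᵢⱼ = ∂ᵢ wⱼ - ∂ⱼ wᵢ`. -/
def curlM {d : ℕ} (w : Ed d → Ed d) (x : Ed d) (i j : Fin d) : ℝ :=
  pd i (fun y => w y j) x - pd j (fun y => w y i) x

/-- `|curl w|²`: in dimension 2 (scalar curl) and 3 (vector curl) this equals
the squared norm of the curl. -/
def curlNormSq {d : ℕ} (w : Ed d → Ed d) (x : Ed d) : ℝ :=
  (1 / 2) * ∑ i, ∑ j, (curlM w x i j) ^ 2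

/-- `j`-th component of `curl curl w` (in dimensions 2 and 3 this is
`∑ i ∂ᵢ (∂ⱼ wᵢ - ∂ᵢ wⱼ) = ∂ⱼ (div w) - Δ wⱼ`). -/
def ccurl {d : ℕ} (w : Ed d → Ed d) (x : Ed d) (j : Fin d) : ℝ :=
  ∑ i, pd i (fun y => curlM w y j i) x

/-- `j`-th component of the componentwise Laplacian of a vector field. -/
def veclap {d : ℕ} (w : Ed d → Ed d) (x : Ed d) (j : Fin d) : ℝ :=
  ∑ i, pd i (fun y => pd i (fun z => w z j) y) x

/-- Time derivative of a time-dependent field. -/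
def tder {α : Type*} {F : Type*} [NormedAddCommGroup F] [NormedSpace ℝ F]
    (u : ℝ → α → F) : ℝ → α → F :=
  fun t x => deriv (fun s => u s x) t

/-- An open, bounded, convex domain in `ℝ^d` (`d ∈ {2,3}`) together with its outward
unit normal field `n` on the boundary.  For a convex body with smooth boundary the
outward unit normal at a boundary point is characterized by the supporting
half-space inequality. -/
structure GoodDomain (d : ℕ) (Ω : Set (Ed d)) (n : Ed d → Ed d) : Prop where
  dims : d = 2 ∨ d = 3
  isOpen : IsOpen Ω
  bounded : Bornology.IsBounded Ω
  convex : Convex ℝ Ω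
  nonempty : Ω.Nonempty
  normal_unit : ∀ x ∈ frontier Ω, ‖n x‖ = 1
  normal_outward : ∀ x ∈ frontier Ω, ∀ y ∈ closure Ω, ∑ i, (y i - x i) * n x i ≤ 0

/-- A smooth solution `(u, θ)` of the thermoelastic system
`u_tt - (2μ+λ)∇(div u) + μ curl curl u = -ν∇θ`, `θ_t - Δθ = -ν θ div u_t`
with boundary conditions `u·n = 0`, `𝒩u = 0` (encoded as `(curl u) n = 0`,
which in dimension 2 means `curl u = 0` and in dimension 3 means
`curl u × n = 0`) and `∇θ·n = 0`, and with positive temperature. -/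
structure IsSolution {d : ℕ} (Ω : Set (Ed d)) (n : Ed d → Ed d)
    (μ lam ν : ℝ) (u : ℝ → Ed d → Ed d) (θ : ℝ → Ed d → ℝ) : Prop where
  smooth_u : ContDiff ℝ (⊤ : ℕ∞) (fun p : ℝ × Ed d => u p.1 p.2)
  smooth_θ : ContDiff ℝ (⊤ : ℕ∞) (fun p : ℝ × Ed d => θ p.1 p.2)
  theta_pos : ∀ t : ℝ, 0 ≤ t → ∀ x ∈ closure Ω, 0 < θ t x
  wave : ∀ t : ℝ, 0 < t → ∀ x ∈ Ω, ∀ j : Fin d,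
    tder (tder u) t x j - (2 * μ + lam) * pd j (divg (u t)) x
      + μ * ccurl (u t) x j = -ν * pd j (θ t) x
  heat : ∀ t : ℝ, 0 < t → ∀ x ∈ Ω,
    tder θ t x - lap (θ t) x = -ν * θ t x * divg (tder u t) x
  bc_u : ∀ t : ℝ, 0 < t → ∀ x ∈ frontier Ω, ∑ i, u t x i * n x i = 0
  bc_N : ∀ t : ℝ, 0 < t → ∀ x ∈ frontier Ω, ∀ i : Fin d,
    ∑ j, curlM (u t) x i j * n x j = 0
  bc_θ : ∀ t : ℝ, 0 < t → ∀ x ∈ frontier Ω, ∑ i, pd i (θ t) x * n x i = 0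

/-- The functional `F(u, u_t, θ)` built from the Fisher information and
higher-order derivatives of the displacement. -/
def Ffun {d : ℕ} (Ω : Set (Ed d)) (μ lam : ℝ)
    (u : ℝ → Ed d → Ed d) (θ : ℝ → Ed d → ℝ) (t : ℝ) : ℝ :=
  (1 / 2) * ((∫ x in Ω, (divg (tder u t) x) ^ 2)
    + (∫ x in Ω, curlNormSq (tder u t) x)
    + (2 * μ + lam) * (∫ x in Ω, gradNormSq (divg (u t)) x)
    + μ * (∫ x in Ω, ∑ j, (ccurl (u t) x j) ^ 2)
    + (∫ x in Ω, gradNormSq (θ t) x / θ t x))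

/-- The small-data condition
`‖div v₀‖² + ‖curl v₀‖² + (2μ+λ)‖∇div u₀‖² + μ‖curl curl u₀‖² + ‖∇θ₀/√θ₀‖² ≤ D`. -/
def smallData {d : ℕ} (Ω : Set (Ed d)) (μ lam : ℝ)
    (u0 v0 : Ed d → Ed d) (θ0 : Ed d → ℝ) (D : ℝ) : Prop :=
  (∫ x in Ω, (divg v0 x) ^ 2) + (∫ x in Ω, curlNormSq v0 x)
    + (2 * μ + lam) * (∫ x in Ω, gradNormSq (divg u0) x)
    + μ * (∫ x in Ω, ∑ j, (ccurl u0 x j) ^ 2)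
    + (∫ x in Ω, gradNormSq θ0 x / θ0 x) ≤ D

/-- The norm `‖w‖_H = (‖div w‖² + ‖curl w‖²)^{1/2}`. -/
def Hnorm {d : ℕ} (Ω : Set (Ed d)) (w : Ed d → Ed d) : ℝ :=
  Real.sqrt ((∫ x in Ω, (divg w x) ^ 2) + (∫ x in Ω, curlNormSq w x))

end

theorem lipschitzWith_min_infDist_compl {X : Type*} [PseudoMetricSpace X] (s : Set X) (ε : ℝ) :
    LipschitzWith 1 fun x : X => min (Metric.infDist x sᶜ) ε :=
  (Metric.lipschitz_infDist_pt sᶜ).min_const ε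

section OuterNormal

open Metric
open scoped RealInnerProductSpace

variable {E : Type*} [NormedAddCommGroup E] [InnerProductSpace ℝ E]

/-- `n` assigns to every boundary point of `Ω` the unit normal of a supporting half-space. -/
def IsOuterNormal (Ω : Set E) (n : E → E) : Prop :=
  ∀ x ∈ frontier Ω, ‖n x‖ = 1 ∧ ∀ y ∈ closure Ω, ⟪y - x, n x⟫ ≤ 0

theorem IsPreconnected.inter_frontier_nonempty {X : Type*} [TopologicalSpace X] {s t : Set X}
    (hs : IsPreconnected s) (h : (s ∩ t).Nonempty) (h' : (s ∩ tᶜ).Nonempty) :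
    (s ∩ frontier t).Nonempty := by
  by_contra hne
  have hdisj : ∀ x ∈ s, x ∉ frontier t := fun x hx hxt => hne ⟨x, hx, hxt⟩
  have hcover : s ⊆ interior t ∪ interior tᶜ := by
    intro x hx
    by_contra hx'
    rw [mem_union, not_or, interior_compl, mem_compl_iff, not_not] at hx'
    exact hdisj x hx ⟨hx'.2, hx'.1⟩
  obtain ⟨x, hx, hxt⟩ := h
  obtain ⟨z, hz, hzt⟩ := h'
  obtain ⟨p, -, hp, hp'⟩ := hs _ _ isOpen_interior isOpen_interior hcover
    ⟨x, hx, (hcover hx).resolve_right fun hc => interior_subset hc hxt⟩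
    ⟨z, hz, (hcover hz).resolve_left fun hc => hzt (interior_subset hc)⟩
  exact interior_subset hp' (interior_subset hp)

namespace IsOuterNormal

variable {Ω : Set E} {n : E → E}

theorem le_inner (hn : IsOuterNormal Ω n) {x y : E} {r : ℝ} (hr : 0 ≤ r)
    (hball : closedBall x r ⊆ closure Ω) (hy : y ∈ frontier Ω) : r ≤ ⟪y - x, n y⟫ := by
  have hmem : x + r • n y ∈ closedBall x r := by
    simp [norm_smul, (hn y hy).1, abs_of_nonneg hr]
  have h := (hn y hy).2 _ (hball hmem)
  have e : x + r • n y - y = r • n y - (y - x) := by abel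
  rw [e, inner_sub_left, real_inner_smul_left, real_inner_self_eq_norm_sq, (hn y hy).1] at h
  linarith

theorem eq_add_smul (hn : IsOuterNormal Ω n) {x y : E}
    (hball : closedBall x (dist x y) ⊆ closure Ω) (hy : y ∈ frontier Ω) :
    y = x + dist x y • n y := by
  have h := hn.le_inner dist_nonneg hball hy
  have hd : dist x y = ‖y - x‖ := by rw [dist_comm, dist_eq_norm]
  have : ‖(y - x) - dist x y • n y‖ ^ 2 ≤ 0 := by
    rw [norm_sub_sq_real, real_inner_smul_right, norm_smul, (hn y hy).1, ← hd, norm_of_nonneg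
      dist_nonneg]
    nlinarith [dist_nonneg (x := x) (y := y)]
  have h0 : (y - x) - dist x y • n y = 0 := by
    rw [← norm_eq_zero]
    exact pow_eq_zero_iff (two_ne_zero) |>.1 (le_antisymm this (sq_nonneg _))
  rw [← sub_eq_zero, ← h0]
  abel

theorem exists_mem_frontier_of_tangent (hn : IsOuterNormal Ω n) {x y a : E} {r K s : ℝ}
    (hball : closedBall x r ⊆ closure Ω) (hy : y ∈ frontier Ω) (hxy : y = x + r • n y)
    (ha : ⟪a, n y⟫ = 0) (hK : 0 < K) (hKa : ‖a‖ ^ 2 ≤ K * r) (hs : 0 < s)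
    (hsK : K * s ^ 2 ≤ r) :
    ∃ c : ℝ, |c| ≤ K * s ^ 2 ∧ y + (s • a + c • n y) ∈ frontier Ω := by
  have hKs : 0 < K * s ^ 2 := by positivity
  let f : ℝ → E := fun c => y + (s • a + c • n y)
  have hpre : IsPreconnected (f '' Icc (-(K * s ^ 2)) (K * s ^ 2)) :=
    isPreconnected_Icc.image f (by fun_prop)
  have hin : f (-(K * s ^ 2)) ∈ closure Ω := by
    apply hball
    rw [mem_closedBall, dist_eq_norm]
    have hr : 0 ≤ r := hKs.le.trans hsK
    refine (sq_le_sq₀ (norm_nonneg _) hr).1 ?_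
    have e : f (-(K * s ^ 2)) - x = s • a + (r - K * s ^ 2) • n y := by
      simp only [f]
      nth_rw 1 [hxy]
      module
    rw [e, norm_add_sq_real, real_inner_smul_left, real_inner_smul_right, ha, norm_smul,
      norm_smul, (hn y hy).1, mul_pow, mul_pow, norm_eq_abs, norm_eq_abs, sq_abs, sq_abs]
    nlinarith [mul_le_mul_of_nonneg_left hKa (sq_nonneg s), mul_le_mul_of_nonneg_left hsK hKs.le]
  have hout : f (K * s ^ 2) ∉ closure Ω := fun h => by
    have := (hn y hy).2 _ h
    simp only [f, add_sub_cancel_left, inner_add_left, real_inner_smul_left, ha,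
      real_inner_self_eq_norm_sq, (hn y hy).1] at this
    linarith
  obtain ⟨_, ⟨c, hc, rfl⟩, hcf⟩ := hpre.inter_frontier_nonempty (t := closure Ω)
    ⟨_, mem_image_of_mem f (left_mem_Icc.2 (by linarith)), hin⟩
    ⟨_, mem_image_of_mem f (right_mem_Icc.2 (by linarith)), hout⟩
  exact ⟨c, abs_le.2 hc, frontier_closure_subset hcf⟩

/-- If a vector field is tangent to the boundary of a set with supporting half-spaces, then at
boundary points touched by an interior ball its derivative along itself points inwards. -/
theorem inner_fderiv_self_nonpos (hn : IsOuterNormal Ω n) {x y : E} {r : ℝ} (hr : 0 < r)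
    (hball : closedBall x r ⊆ closure Ω) (hy : y ∈ frontier Ω) (hxy : y = x + r • n y)
    {w : E → E} {A : E →L[ℝ] E} (hw : HasFDerivAt w A y)
    (htan : ∀ z ∈ frontier Ω, ⟪w z, n z⟫ = 0) : ⟪A (w y), n y⟫ ≤ 0 := by
  set a := w y
  have hny := (hn y hy).1
  obtain ⟨K, hK, hKa⟩ : ∃ K : ℝ, 0 < K ∧ ‖a‖ ^ 2 ≤ K * r :=
    ⟨‖a‖ ^ 2 / r + 1, by positivity, by rw [add_mul, div_mul_cancel₀ _ hr.ne']; linarith⟩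
  have hpt : ∀ s : ℝ, ∃ c : ℝ, 0 < s → K * s ^ 2 ≤ r →
      |c| ≤ K * s ^ 2 ∧ y + (s • a + c • n y) ∈ frontier Ω := by
    intro s
    by_cases h : 0 < s ∧ K * s ^ 2 ≤ r
    · obtain ⟨c, hc⟩ :=
        hn.exists_mem_frontier_of_tangent hball hy hxy (htan y hy) hK hKa h.1 h.2
      exact ⟨c, fun _ _ => hc⟩
    · exact ⟨0, fun h1 h2 => absurd ⟨h1, h2⟩ h⟩
  choose c hc using hpt
  have hpos : ∀ᶠ s : ℝ in 𝓝[>] 0, 0 < s := self_mem_nhdsWithin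
  have hid : Tendsto (fun s : ℝ => s) (𝓝[>] 0) (𝓝 0) :=
    tendsto_nhdsWithin_of_tendsto_nhds tendsto_id
  have hKs : Tendsto (fun s : ℝ => K * s ^ 2) (𝓝[>] 0) (𝓝 0) := by
    simpa using (hid.pow 2).const_mul K
  have hsmall : ∀ᶠ s : ℝ in 𝓝[>] 0, K * s ^ 2 ≤ r := (hKs.eventually_lt_const hr).mono
    fun _ h => h.le
  have hc0 : Tendsto c (𝓝[>] 0) (𝓝 0) := by
    refine squeeze_zero_norm' ?_ hKs
    filter_upwards [hpos, hsmall] with s h1 h2 using (hc s h1 h2).1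
  have hcs : Tendsto (fun s => s⁻¹ * c s) (𝓝[>] 0) (𝓝 0) := by
    have hKs1 : Tendsto (fun s : ℝ => K * s) (𝓝[>] 0) (𝓝 0) := by simpa using hid.const_mul K
    refine squeeze_zero_norm' ?_ hKs1
    filter_upwards [hpos, hsmall] with s h1 h2
    rw [norm_mul, norm_inv, norm_eq_abs, norm_eq_abs, abs_of_pos h1, inv_mul_le_iff₀ h1]
    linarith [(hc s h1 h2).1]
  let z : ℝ → E := fun s => y + (s • a + c s • n y)
  have hdiff : Tendsto (fun s : ℝ => s⁻¹ • (w (z s) - w y)) (𝓝[>] 0) (𝓝 (A a)) := by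
    refine (hasFDerivWithinAt_univ.2 hw).lim ?_ (.of_forall fun _ => mem_univ _) ?_
    · simpa using (hid.smul_const a).add (hc0.smul_const (n y))
    · have : Tendsto (fun s => a + (s⁻¹ * c s) • n y) (𝓝[>] 0) (𝓝 a) := by
        simpa using (hcs.smul_const (n y)).const_add a
      refine this.congr' ?_
      filter_upwards [hpos] with s h1
      rw [smul_add, smul_smul, smul_smul, inv_mul_cancel₀ h1.ne', one_smul]
  have hbd : ∀ᶠ s in 𝓝[>] 0, 0 ≤ s * ⟪a, n (z s)⟫ + c s * ⟪n y, n (z s)⟫ ∧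
      r ≤ s * ⟪a, n (z s)⟫ + (r + c s) * ⟪n y, n (z s)⟫ ∧ c s ≤ 0 ∧ ‖n (z s)‖ = 1 ∧
      ⟪w (z s), n (z s)⟫ = 0 := by
    filter_upwards [hpos, hsmall] with s h1 h2
    have hz : z s ∈ frontier Ω := (hc s h1 h2).2
    have ha0 : ⟪a, n y⟫ = 0 := htan y hy
    refine ⟨?_, ?_, ?_, (hn _ hz).1, htan _ hz⟩
    · have := (hn _ hz).2 y hy.1
      have e : y - z s = -(s • a + c s • n y) := by simp only [z]; abel
      rw [e, inner_neg_left, inner_add_left, real_inner_smul_left, real_inner_smul_left] at this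
      linarith
    · have := hn.le_inner hr.le hball hz
      have e : z s - x = s • a + (r + c s) • n y := by
        simp only [z]
        nth_rw 1 [hxy]
        module
      rwa [e, inner_add_left, real_inner_smul_left, real_inner_smul_left] at this
    · have := (hn _ hy).2 _ hz.1
      have e : z s - y = s • a + c s • n y := by simp only [z]; abel
      rw [e, inner_add_left, real_inner_smul_left, real_inner_smul_left, ha0,
        real_inner_self_eq_norm_sq, hny] at this
      linarith
  have hnz : Tendsto (fun s => n (z s)) (𝓝[>] 0) (𝓝 (n y)) := by
    rw [tendsto_iff_norm_sub_tendsto_zero]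
    have hlim : Tendsto (fun s => 2 / r * (s * ‖a‖ + |c s|)) (𝓝[>] 0) (𝓝 0) := by
      simpa using ((hid.mul_const ‖a‖).add hc0.abs).const_mul (2 / r)
    have hsq : Tendsto (fun s => ‖n (z s) - n y‖ ^ 2) (𝓝[>] 0) (𝓝 0) := by
      refine squeeze_zero' (.of_forall fun _ => sq_nonneg _) ?_ hlim
      filter_upwards [hpos, hbd] with s h1 ⟨_, h3, _, h5, _⟩
      have i1 := real_inner_le_norm a (n (z s))
      have i2 := abs_real_inner_le_norm (n y) (n (z s))
      rw [h5, mul_one] at i1 i2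
      rw [hny] at i2
      have i3 : c s * ⟪n y, n (z s)⟫ ≤ |c s| :=
        (le_abs_self _).trans (by rw [abs_mul]; exact mul_le_of_le_one_right (abs_nonneg _) i2)
      rw [norm_sub_sq_real, h5, hny, real_inner_comm, div_mul_eq_mul_div, le_div_iff₀ hr]
      nlinarith [mul_le_mul_of_nonneg_left i1 h1.le]
    have := hsq.sqrt
    simpa using this
  have hinner : Tendsto (fun s => ⟪n y, n (z s)⟫) (𝓝[>] 0) (𝓝 1) := by
    have := (tendsto_const_nhds (x := n y)).inner (𝕜 := ℝ) hnz
    rwa [real_inner_self_eq_norm_sq, hny, one_pow] at this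
  refine le_of_tendsto (hdiff.inner hnz) ?_
  filter_upwards [hpos, hbd, hinner.eventually_const_lt one_pos] with s h1 ⟨h2, _, h4, _, h6⟩ h7
  rw [real_inner_smul_left, inner_sub_left, h6, zero_sub]
  have : 0 ≤ ⟪a, n (z s)⟫ := by nlinarith
  exact mul_nonpos_of_nonneg_of_nonpos (inv_nonneg.2 h1.le) (neg_nonpos.2 this)

theorem fderiv_min_infDist_compl (hn : IsOuterNormal Ω n) [FiniteDimensional ℝ E]
    (ho : IsOpen Ω) (hΩ : Ω ≠ univ) {ε : ℝ} (hε : 0 < ε) {x : E}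
    (hd : DifferentiableAt ℝ (fun z => min (infDist z Ωᶜ) ε) x) :
    fderiv ℝ (fun z => min (infDist z Ωᶜ) ε) x = 0 ∨
      x ∈ Ω ∧ infDist x Ωᶜ < ε ∧ ∃ y ∈ frontier Ω, infDist x Ωᶜ = dist x y ∧
        fderiv ℝ (fun z => min (infDist z Ωᶜ) ε) x = -innerSL ℝ (n y) := by
  by_cases hx : x ∈ Ω
  swap
  · left
    refine IsLocalMin.fderiv_eq_zero (.of_forall fun z => ?_)
    dsimp only
    rw [infDist_zero_of_mem (show x ∈ Ωᶜ from hx), min_eq_left hε.le]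
    exact le_min infDist_nonneg hε.le
  rcases le_or_gt ε (infDist x Ωᶜ) with h | h
  · left
    refine IsLocalMax.fderiv_eq_zero (.of_forall fun z => ?_)
    dsimp only
    rw [min_eq_right h]
    exact min_le_right _ _
  obtain ⟨y, hy, hxy⟩ := exists_mem_frontier_infDist_compl_eq_dist hx hΩ
  refine .inr ⟨hx, h, y, hy, hxy, ?_⟩
  have hball := closedBall_infDist_compl_subset_closure hx
  have heq : infDist x Ωᶜ = ⟪y - x, n y⟫ := by
    have e := hn.eq_add_smul (hxy ▸ hball) hy
    have e' : y - x = dist x y • n y := by rw [sub_eq_iff_eq_add']; exact e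
    rw [e', real_inner_smul_left, real_inner_self_eq_norm_sq, (hn y hy).1, hxy]
    ring
  have hmax : IsLocalMax ((fun z => min (infDist z Ωᶜ) ε) + fun z => innerSL ℝ (n y) z) x := by
    filter_upwards [ho.mem_nhds hx] with z hz
    have h1 := hn.le_inner infDist_nonneg (closedBall_infDist_compl_subset_closure hz) hy
    simp only [Pi.add_apply, innerSL_apply_apply, min_eq_left h.le]
    rw [inner_sub_left] at h1 heq
    rw [real_inner_comm z, real_inner_comm x]
    linarith [min_le_left (infDist z Ωᶜ) ε]
  have h0 := hmax.fderiv_eq_zero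
  rw [fderiv_add hd (innerSL ℝ (n y)).differentiableAt, ContinuousLinearMap.fderiv] at h0
  exact eq_neg_of_add_eq_zero_left h0

end IsOuterNormal

section IntegrationByParts

variable [FiniteDimensional ℝ E] {f g : E → ℝ}

theorem exists_contDiff_hasCompactSupport_eqOn (hf : ContDiff ℝ 1 f) {K : Set E}
    (hK : Bornology.IsBounded K) :
    ∃ h : E → ℝ, ContDiff ℝ 1 h ∧ HasCompactSupport h ∧ ∀ x ∈ K, h =ᶠ[𝓝 x] f := by
  obtain ⟨R, hR, hKR⟩ := hK.subset_ball_lt 0 0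
  let χ : ContDiffBump (0 : E) := ⟨R, R + 1, hR, by linarith⟩
  refine ⟨fun x => χ x * f x, χ.contDiff.mul hf, χ.hasCompactSupport.mul_right, fun x hx => ?_⟩
  filter_upwards [χ.eventuallyEq_one_of_mem_ball (hKR hx)] with z hz
  simp [hz]

variable [MeasurableSpace E] [BorelSpace E] {μ : Measure E} [μ.IsAddHaarMeasure]

theorem LipschitzWith.integrable_mul_fderiv {D : NNReal} (hf : ContDiff ℝ 1 f)
    (hg : LipschitzWith D g) (hgs : HasCompactSupport g) (v : E) :
    Integrable (fun x => f x * fderiv ℝ g x v) μ := by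
  obtain ⟨h, hh, hhs, hhf⟩ := exists_contDiff_hasCompactSupport_eqOn hf hgs.isCompact.isBounded
  have hint : Integrable (fun x => lineDeriv ℝ g x v * h x) μ :=
    (hh.continuous.integrable_of_hasCompactSupport hhs).bdd_mul
      (aestronglyMeasurable_lineDeriv hg.continuous μ)
      (.of_forall fun _ => norm_lineDeriv_le_of_lipschitz ℝ hg)
  refine hint.congr ?_
  filter_upwards [hg.ae_differentiableAt (μ := μ)] with x hx
  rw [hx.lineDeriv_eq_fderiv, mul_comm]
  by_cases hxs : x ∈ tsupport g
  · rw [(hhf x hxs).eq_of_nhds]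
  · simp [fderiv_of_notMem_tsupport ℝ hxs]

theorem LipschitzWith.integral_fderiv_mul {D : NNReal} (hf : ContDiff ℝ 1 f)
    (hg : LipschitzWith D g) (hgs : HasCompactSupport g) (v : E) :
    ∫ x, fderiv ℝ f x v * g x ∂μ = -∫ x, f x * fderiv ℝ g x v ∂μ := by
  obtain ⟨h, hh, hhs, hhf⟩ := exists_contDiff_hasCompactSupport_eqOn hf hgs.isCompact.isBounded
  obtain ⟨C, hC⟩ := hh.lipschitzWith_of_hasCompactSupport hhs one_ne_zero
  have key := hC.integral_lineDeriv_mul_eq (μ := μ) hg hgs v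
  rw [← integral_neg]
  convert key using 1
  · congr 1 with x
    rw [((hh.differentiable one_ne_zero) x).lineDeriv_eq_fderiv]
    by_cases hxs : x ∈ tsupport g
    · rw [(hhf x hxs).fderiv_eq]
    · simp [image_eq_zero_of_notMem_tsupport hxs]
  · refine integral_congr_ae ?_
    filter_upwards [hg.ae_differentiableAt (μ := μ)] with x hx
    rw [hx.lineDeriv_eq_fderiv, map_neg, neg_mul, mul_comm]
    by_cases hxs : x ∈ tsupport g
    · rw [(hhf x hxs).eq_of_nhds]
    · simp [fderiv_of_notMem_tsupport ℝ hxs]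

end IntegrationByParts

namespace IsOuterNormal

variable {Ω : Set E} {n : E → E} [FiniteDimensional ℝ E] {ι : Type*} [Fintype ι]
  {b : OrthonormalBasis ι ℝ E} {G : E → E →L[ℝ] ℝ}

theorem hasCompactSupport_min_infDist_compl (hb : Bornology.IsBounded Ω) {ε : ℝ} (hε : 0 < ε) :
    HasCompactSupport fun x => min (infDist x Ωᶜ) ε := by
  refine HasCompactSupport.intro hb.isCompact_closure fun x hx => ?_
  rw [infDist_zero_of_mem (show x ∈ Ωᶜ from fun h => hx (subset_closure h)), min_eq_left hε.le]

theorem tendsto_measureReal_infDist_compl_lt [MeasurableSpace E] [BorelSpace E] {μ : Measure E}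
    [μ.IsAddHaarMeasure] (ho : IsOpen Ω) (hb : Bornology.IsBounded Ω) (hΩ : Ω ≠ univ) :
    Tendsto (fun ε => μ.real {x | x ∈ Ω ∧ infDist x Ωᶜ < ε}) (𝓝[>] 0) (𝓝 0) := by
  have hmeas : ∀ ε, MeasurableSet {x | x ∈ Ω ∧ infDist x Ωᶜ < ε} := fun ε =>
    ho.measurableSet.inter (measurableSet_lt (continuous_infDist_pt _).measurable measurable_const)
  have h := tendsto_measure_biInter_gt (μ := μ) (a := (0 : ℝ))
    (s := fun ε => {x | x ∈ Ω ∧ infDist x Ωᶜ < ε}) (fun ε _ => (hmeas ε).nullMeasurableSet)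
    (fun i j _ hij x hx => ⟨hx.1, hx.2.trans_le hij⟩)
    ⟨1, one_pos, ((measure_mono fun x hx => hx.1).trans_lt hb.measure_lt_top).ne⟩
  have hempty : ⋂ r > (0 : ℝ), {x | x ∈ Ω ∧ infDist x Ωᶜ < r} = ∅ := by
    refine eq_empty_of_forall_notMem fun x hx => ?_
    simp only [mem_iInter, mem_ofPred_eq] at hx
    have hxΩ := (hx 1 one_pos).1
    have hpos : 0 < infDist x Ωᶜ :=
      (ho.isClosed_compl.notMem_iff_infDist_pos (nonempty_compl.2 hΩ)).1 fun h => h hxΩ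
    exact lt_irrefl _ (hx _ hpos).2
  rw [hempty, measure_empty] at h
  exact (ENNReal.tendsto_toReal ENNReal.zero_ne_top).comp h

/-- The weak form of the divergence theorem on a bounded convex set, tested against the truncated
distance to the boundary, for a covector field pointing inwards along the boundary. -/
theorem integral_divergence_mul_min_infDist_le [MeasurableSpace E] [BorelSpace E]
    {μ : Measure E} [μ.IsAddHaarMeasure] (hn : IsOuterNormal Ω n) (ho : IsOpen Ω)
    (hb : Bornology.IsBounded Ω) (hΩ : Ω ≠ univ) (hG : ContDiff ℝ 1 G) {L : NNReal}
    (hL : LipschitzOnWith L G (closure Ω))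
    (hGn : ∀ x ∈ Ω, ∀ y ∈ frontier Ω, infDist x Ωᶜ = dist x y → G y (n y) ≤ 0)
    {ε : ℝ} (hε : 0 < ε) :
    ∫ x, (∑ i, fderiv ℝ (fun z => G z (b i)) x (b i)) * min (infDist x Ωᶜ) ε ∂μ ≤
      L * ε * μ.real {x | x ∈ Ω ∧ infDist x Ωᶜ < ε} := by
  set ψ : E → ℝ := fun x => min (infDist x Ωᶜ) ε
  set S := {x | x ∈ Ω ∧ infDist x Ωᶜ < ε}
  have hS : MeasurableSet S :=
    ho.measurableSet.inter (measurableSet_lt (continuous_infDist_pt _).measurable measurable_const)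
  have hSfin : μ S ≠ ⊤ := ((measure_mono fun x hx => hx.1).trans_lt hb.measure_lt_top).ne
  have hψ : LipschitzWith 1 ψ := lipschitzWith_min_infDist_compl Ω ε
  have hψs : HasCompactSupport ψ := hasCompactSupport_min_infDist_compl hb hε
  have hGb : ∀ i, ContDiff ℝ 1 fun z => G z (b i) := fun i => hG.clm_apply contDiff_const
  have hint : ∀ i, Integrable (fun x => G x (b i) * fderiv ℝ ψ x (b i)) μ := fun i =>
    hψ.integrable_mul_fderiv (hGb i) hψs _
  have hint' : ∀ i, Integrable (fun x => fderiv ℝ (fun z => G z (b i)) x (b i) * ψ x) μ := fun i =>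
    ((((hGb i).continuous_fderiv one_ne_zero).clm_apply continuous_const).mul
      hψ.continuous).integrable_of_hasCompactSupport hψs.mul_left
  simp_rw [Finset.sum_mul]
  rw [integral_finsetSum _ fun i _ => hint' i]
  simp_rw [fun i => hψ.integral_fderiv_mul (μ := μ) (hGb i) hψs (b i)]
  rw [Finset.sum_neg_distrib, ← integral_finsetSum _ fun i _ => hint i, ← integral_neg]
  have hle : ∫ x, -∑ i, G x (b i) * fderiv ℝ ψ x (b i) ∂μ ≤
      ∫ x, S.indicator (fun _ => L * ε) x ∂μ := by
    refine integral_mono_ae (integrable_finsetSum _ fun i _ => hint i).neg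
      ((integrable_indicator_iff hS).2 (integrableOn_const hSfin)) ?_
    filter_upwards [hψ.ae_differentiableAt (μ := μ)] with x hx
    rcases hn.fderiv_min_infDist_compl ho hΩ hε hx with h | ⟨hxΩ, hxε, y, hy, hxy, h⟩
    · simp only [ψ, h, zero_apply, mul_zero, Finset.sum_const_zero, neg_zero]
      exact indicator_nonneg (fun _ _ => by positivity) x
    · have hsum : -∑ i, G x (b i) * fderiv ℝ ψ x (b i) = G x (n y) := by
        conv_rhs => rw [← b.sum_repr' (n y), map_sum]
        simp only [ψ, h, neg_apply, innerSL_apply_apply, mul_neg,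
          Finset.sum_neg_distrib, neg_neg, map_smul, smul_eq_mul]
        exact Finset.sum_congr rfl fun i _ => by rw [real_inner_comm, mul_comm]
      rw [hsum, indicator_of_mem (show x ∈ S from ⟨hxΩ, hxε⟩)]
      have h1 : G x (n y) - G y (n y) ≤ L * dist x y := by
        calc G x (n y) - G y (n y) = (G x - G y) (n y) := rfl
          _ ≤ ‖G x - G y‖ * ‖n y‖ := (le_abs_self _).trans ((G x - G y).le_opNorm _)
          _ ≤ L * dist x y := by
            rw [(hn y hy).1, mul_one, ← dist_eq_norm]
            exact hL.dist_le_mul _ (subset_closure hxΩ) _ hy.1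
      have h2 : L * dist x y ≤ L * ε :=
        mul_le_mul_of_nonneg_left (hxy ▸ hxε.le) L.coe_nonneg
      linarith [hGn x hxΩ y hy hxy]
  refine hle.trans_eq ?_
  rw [integral_indicator_const _ hS, smul_eq_mul, mul_comm]

/-- A covector field with nonnegative divergence that points inwards along the boundary of a
bounded convex domain is divergence free. -/
theorem divergence_eq_zero (hn : IsOuterNormal Ω n) (ho : IsOpen Ω)
    (hb : Bornology.IsBounded Ω) (hΩ : Ω ≠ univ) (hc : Convex ℝ Ω) (hG : ContDiff ℝ 1 G)
    (hGn : ∀ x ∈ Ω, ∀ y ∈ frontier Ω, infDist x Ωᶜ = dist x y → G y (n y) ≤ 0)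
    (hdiv : ∀ x ∈ Ω, 0 ≤ ∑ i, fderiv ℝ (fun z => G z (b i)) x (b i)) :
    ∀ x ∈ Ω, ∑ i, fderiv ℝ (fun z => G z (b i)) x (b i) = 0 := by
  borelize E
  let μ : Measure E := (volume : Measure E)
  intro x₀ hx₀
  by_contra hne
  set Q : E → ℝ := fun x => ∑ i, fderiv ℝ (fun z => G z (b i)) x (b i)
  have hq : 0 < Q x₀ := lt_of_le_of_ne (hdiv x₀ hx₀) (Ne.symm hne)
  have hδ : 0 < infDist x₀ Ωᶜ :=
    (ho.isClosed_compl.notMem_iff_infDist_pos (nonempty_compl.2 hΩ)).1 fun h => h hx₀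
  have hQc : Continuous Q := continuous_finsetSum _ fun i _ =>
    (((hG.clm_apply contDiff_const).continuous_fderiv one_ne_zero).clm_apply continuous_const)
  obtain ⟨L, hL⟩ := hG.contDiffOn.exists_lipschitzOnWith one_ne_zero hc.closure
    hb.isCompact_closure
  let B : Set E := {x | Q x₀ / 2 < Q x ∧ infDist x₀ Ωᶜ / 2 < infDist x Ωᶜ}
  have hBo : IsOpen B := (isOpen_lt continuous_const hQc).inter
    (isOpen_lt continuous_const (continuous_infDist_pt _))
  have hBΩ : B ⊆ Ω := fun x hx => by
    by_contra hxΩ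
    have := hx.2
    rw [infDist_zero_of_mem (show x ∈ Ωᶜ from hxΩ)] at this
    linarith
  have hBfin : μ B ≠ ⊤ := ((measure_mono hBΩ).trans_lt hb.measure_lt_top).ne
  have hBpos : 0 < μ.real B := ENNReal.toReal_pos
    (hBo.measure_pos μ ⟨x₀, half_lt_self hq, half_lt_self hδ⟩).ne' hBfin
  have hev : ∀ᶠ ε in 𝓝[>] (0 : ℝ),
      Q x₀ / 2 * μ.real B ≤ L * μ.real {x | x ∈ Ω ∧ infDist x Ωᶜ < ε} := by
    filter_upwards [Ioo_mem_nhdsGT (half_pos hδ)] with ε ⟨hε, hεδ⟩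
    have hupper := hn.integral_divergence_mul_min_infDist_le (μ := μ) (b := b) ho hb hΩ hG hL hGn hε
    have hlower : ∫ x, B.indicator (fun _ => Q x₀ / 2 * ε) x ∂μ ≤
        ∫ x, Q x * min (infDist x Ωᶜ) ε ∂μ := by
      refine integral_mono ((integrable_indicator_iff hBo.measurableSet).2
        (integrableOn_const hBfin)) ((hQc.mul (lipschitzWith_min_infDist_compl Ω
          ε).continuous).integrable_of_hasCompactSupport
          (hasCompactSupport_min_infDist_compl hb hε).mul_left) fun x => ?_
      by_cases hx : x ∈ B
      · rw [indicator_of_mem hx]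
        dsimp only
        rw [min_eq_right (hεδ.trans hx.2).le]
        exact mul_le_mul_of_nonneg_right hx.1.le hε.le
      · rw [indicator_of_notMem hx]
        by_cases hxΩ : x ∈ Ω
        · exact mul_nonneg (hdiv x hxΩ) (le_min infDist_nonneg hε.le)
        · simp [infDist_zero_of_mem (show x ∈ Ωᶜ from hxΩ), min_eq_left hε.le]
    rw [integral_indicator_const _ hBo.measurableSet, smul_eq_mul] at hlower
    have := hlower.trans hupper
    refine le_of_mul_le_mul_right ?_ hε
    linarith
  have hlim := (tendsto_measureReal_infDist_compl_lt (μ := μ) ho hb hΩ).const_mul (L : ℝ)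
  rw [mul_zero] at hlim
  exact absurd (ge_of_tendsto hlim hev) (not_le.2 (by positivity))

/-- A harmonic vector field on a bounded convex domain that is tangent to the boundary and has
symmetric derivative in the normal direction vanishes. -/
theorem eq_zero_of_harmonic (hn : IsOuterNormal Ω n) (ho : IsOpen Ω)
    (hb : Bornology.IsBounded Ω) (hΩ : Ω ≠ univ) (hc : Convex ℝ Ω) (b : OrthonormalBasis ι ℝ E)
    {w : E → E} (hw : ContDiff ℝ 2 w)
    (hharm : ∀ x ∈ Ω, ∑ i, fderiv ℝ (fun z => fderiv ℝ w z (b i)) x (b i) = 0)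
    (htan : ∀ y ∈ frontier Ω, ⟪w y, n y⟫ = 0)
    (hcurl : ∀ y ∈ frontier Ω, ∀ v, ⟪fderiv ℝ w y v, n y⟫ = ⟪v, fderiv ℝ w y (n y)⟫) :
    ∀ x ∈ Ω, w x = 0 := by
  have hwd : Differentiable ℝ w := hw.differentiable two_ne_zero
  have hw' : ContDiff ℝ 1 (fderiv ℝ w) := hw.fderiv_right (by norm_num)
  have hGc : ContDiff ℝ 1 fun x => (innerSL ℝ (w x)).comp (fderiv ℝ w x) :=
    ((innerSL ℝ).contDiff.comp (hw.of_le one_le_two)).clm_comp hw'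
  have hdiv : ∀ x ∈ Ω, ∑ i, fderiv ℝ (fun z => (innerSL ℝ (w z)).comp (fderiv ℝ w z) (b i)) x (b i)
      = ∑ i, ‖fderiv ℝ w x (b i)‖ ^ 2 := by
    intro x hx
    have h1 : ∀ i, fderiv ℝ (fun z => (innerSL ℝ (w z)).comp (fderiv ℝ w z) (b i)) x (b i) =
        ⟪w x, fderiv ℝ (fun z => fderiv ℝ w z (b i)) x (b i)⟫ + ‖fderiv ℝ w x (b i)‖ ^ 2 := by
      intro i
      simp only [ContinuousLinearMap.comp_apply, innerSL_apply_apply]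
      rw [fderiv_inner_apply ℝ (hwd x)
        ((hw'.clm_apply contDiff_const).differentiable one_ne_zero x), real_inner_self_eq_norm_sq]
    rw [Finset.sum_congr rfl fun i _ => h1 i, Finset.sum_add_distrib, ← inner_sum, hharm x hx,
      inner_zero_right, zero_add]
  have hzero := hn.divergence_eq_zero (b := b) ho hb hΩ hc hGc (fun x hx y hy hxy => by
    have hball := closedBall_infDist_compl_subset_closure hx
    rw [hxy] at hball
    have hr : 0 < dist x y := hxy ▸
      (ho.isClosed_compl.notMem_iff_infDist_pos (nonempty_compl.2 hΩ)).1 fun h => h hx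
    have := hn.inner_fderiv_self_nonpos hr hball hy (hn.eq_add_smul hball hy)
      (hwd y).hasFDerivAt htan
    rwa [hcurl y hy] at this) fun x hx => by
    rw [hdiv x hx]
    exact Finset.sum_nonneg fun i _ => sq_nonneg _
  have hfderiv : Ω.EqOn (fderiv ℝ w) 0 := fun x hx => by
    have h := hzero x hx
    rw [hdiv x hx, Finset.sum_eq_zero_iff_of_nonneg fun i _ => sq_nonneg _] at h
    refine ContinuousLinearMap.coe_injective (b.toBasis.ext fun i => ?_)
    simpa using h i (Finset.mem_univ i)
  intro x hx
  by_contra hne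
  have hconst : EqOn w (fun _ => w x) (closure Ω) := EqOn.closure
    (fun z hz => ho.is_const_of_fderiv_eq_zero hc.isPreconnected hwd.differentiableOn hfderiv hz hx)
    hwd.continuous continuous_const
  obtain ⟨_, ⟨t, ht, rfl⟩, hy⟩ := (isPreconnected_Ici.image (fun t : ℝ => x + t • w x)
    (by fun_prop)).inter_frontier_nonempty (s := (fun t : ℝ => x + t • w x) '' Ici 0) (t := Ω)
    ⟨x, ⟨0, by simp, by simp⟩, hx⟩ (by
      obtain ⟨R, hR, hΩR⟩ := hb.subset_closedBall_lt 0 x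
      refine ⟨_, ⟨(R + 1) / ‖w x‖, by simp only [mem_Ici]; positivity, rfl⟩, fun h => ?_⟩
      have := hΩR h
      rw [mem_closedBall, dist_eq_norm, add_sub_cancel_left, norm_smul, norm_div, norm_norm,
        div_mul_cancel₀ _ (norm_ne_zero_iff.2 hne), norm_of_nonneg (by positivity)] at this
      linarith)
  have h1 := hn.le_inner infDist_nonneg (closedBall_infDist_compl_subset_closure hx) hy
  have h2 := htan _ hy
  rw [hconst hy.1] at h2
  rw [add_sub_cancel_left, real_inner_smul_left, h2, mul_zero] at h1
  exact absurd h1 (not_le.2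
    ((ho.isClosed_compl.notMem_iff_infDist_pos (nonempty_compl.2 hΩ)).1 fun h => h hx))

end IsOuterNormal

end OuterNormal

theorem pd_apply_eq {d : ℕ} {w : Ed d → Ed d} {x : Ed d} (hw : DifferentiableAt ℝ w x)
    (i j : Fin d) :
    pd i (fun y => w y j) x = fderiv ℝ w x (EuclideanSpace.single i 1) j := by
  have h := ((EuclideanSpace.proj (𝕜 := ℝ) j).hasFDerivAt.comp x hw.hasFDerivAt).fderiv
  change fderiv ℝ (fun y => w y j) x = _ at h
  rw [pd, h]
  rfl

theorem veclap_eq {d : ℕ} {w : Ed d → Ed d} (hw : ContDiff ℝ 2 w) (x : Ed d) (j : Fin d) :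
    veclap w x j = (∑ i, fderiv ℝ (fun z => fderiv ℝ w z (EuclideanSpace.basisFun (Fin d) ℝ i)) x
      (EuclideanSpace.basisFun (Fin d) ℝ i)) j := by
  have hw' : ContDiff ℝ 1 (fderiv ℝ w) := hw.fderiv_right (by norm_num)
  rw [veclap, WithLp.ofLp_sum, Finset.sum_apply]
  refine Finset.sum_congr rfl fun i _ => ?_
  simp_rw [pd_apply_eq (hw.differentiable two_ne_zero _)]
  rw [pd_apply_eq ((hw'.clm_apply contDiff_const).differentiable one_ne_zero _)]
  simp

theorem sum_curlM_mul_eq {d : ℕ} {w : Ed d → Ed d} {x : Ed d} (hw : DifferentiableAt ℝ w x)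
    (i : Fin d) (v : Ed d) :
    ∑ j, curlM w x i j * v j = inner ℝ (fderiv ℝ w x (EuclideanSpace.single i 1)) v -
      inner ℝ (EuclideanSpace.single i 1) (fderiv ℝ w x v) := by
  have hv : fderiv ℝ w x v i = ∑ j, fderiv ℝ w x (EuclideanSpace.single j 1) i * v j := by
    conv_lhs => rw [← (EuclideanSpace.basisFun (Fin d) ℝ).sum_repr v]
    simp [map_sum, mul_comm]
  simp only [curlM, pd_apply_eq hw, sub_mul, Finset.sum_sub_distrib]
  rw [EuclideanSpace.inner_single_left, hv]
  simp [PiLp.inner_apply, mul_comm]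

/-- a harmonic vector field with `w·n = 0` and `𝒩w = 0` on the
boundary vanishes. -/
theorem harmonic_vector_field_zero {d : ℕ} {Ω : Set (Ed d)} {n : Ed d → Ed d}
    (hdom : GoodDomain d Ω n) (w : Ed d → Ed d) (hw : ContDiff ℝ 2 w)
    (hharm : ∀ x ∈ Ω, ∀ j : Fin d, veclap w x j = 0)
    (hbc1 : ∀ x ∈ frontier Ω, ∑ i, w x i * n x i = 0)
    (hbc2 : ∀ x ∈ frontier Ω, ∀ i : Fin d, ∑ j, curlM w x i j * n x j = 0) :
    ∀ x ∈ Ω, w x = 0 := by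
  have hn : IsOuterNormal Ω n := fun x hx => ⟨hdom.normal_unit x hx, fun y hy => by
    simpa [PiLp.inner_apply, mul_comm] using hdom.normal_outward x hx y hy⟩
  have : NeZero d := ⟨by rcases hdom.dims with h | h <;> omega⟩
  have hΩ : Ω ≠ univ := by
    rintro rfl
    exact NormedSpace.unbounded_univ ℝ (Ed d) hdom.bounded
  have hwd : Differentiable ℝ w := hw.differentiable two_ne_zero
  refine hn.eq_zero_of_harmonic hdom.isOpen hdom.bounded hΩ hdom.convex
    (EuclideanSpace.basisFun (Fin d) ℝ) hw (fun x hx => ?_) (fun y hy => ?_) fun y hy v => ?_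
  · ext j
    rw [← veclap_eq hw, hharm x hx j]
    rfl
  · simpa [PiLp.inner_apply, mul_comm] using hbc1 y hy
  · have h := fun i => sub_eq_zero.1 ((sum_curlM_mul_eq (hwd y) i (n y)).symm.trans (hbc2 y hy i))
    rw [← (EuclideanSpace.basisFun (Fin d) ℝ).sum_repr v]
    simp only [map_sum, map_smul, sum_inner, inner_smul_left, EuclideanSpace.basisFun_apply, h]
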